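/- arXiv:2602.06758 — 3 statements merged into one kernel-verified Lean document; each statement's English description precedes it below -/
import Mathlib

section
/- Let y be a real number with 0 < y ≤ 1. Then the infimum over integers v ≥ 3 of J_v(y) = 2·F_v(y·√(v/(v−2))) − 1 equals 2·Φ(y) − 1, where Φ is the standard normal distribution function. Equivalently, the infimum over integers v ≥ 3 of the probability P(|X_v| ≤ y·√(v/(v−2))) for a t-distributed random variable X_v with v degrees of freedom equals 2·Φ(y) − 1. -/
open MeasureTheory Real

/-- The Student t density with `v` degrees of freedom. -/
noncomputable def tDensity (v x : ℝ) : ℝ :=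
  Real.Gamma ((v + 1) / 2) / (Real.sqrt (v * π) * Real.Gamma (v / 2)) *
    (1 + x ^ 2 / v) ^ (-((v + 1) / 2))

/-- The Student t distribution function. -/
noncomputable def tCDF (v t : ℝ) : ℝ := ∫ x in Set.Iic t, tDensity v x

/-- `J v y = P(|X_v| ≤ y √(v/(v-2)))`. -/
noncomputable def J (v y : ℝ) : ℝ := 2 * tCDF v (y * Real.sqrt (v / (v - 2))) - 1

/-- The standard normal distribution function. -/
noncomputable def Φ (x : ℝ) : ℝ :=
  (1 / Real.sqrt (2 * π)) * ∫ u in Set.Iic x, Real.exp (-(u ^ 2) / 2)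
open Set Filter Topology

/-! ### Inequalities for the Gaussian integral -/

/-- A function with nonnegative derivative on `[a, b]` satisfies `f a ≤ f b`. -/
theorem le_of_hasDerivAt_nonneg {f f' : ℝ → ℝ} {a b : ℝ} (hab : a ≤ b)
    (hf : ∀ x ∈ Icc a b, HasDerivAt f (f' x) x) (hf' : ∀ x ∈ Icc a b, 0 ≤ f' x) : f a ≤ f b := by
  refine monotoneOn_of_hasDerivWithinAt_nonneg (f' := f') (convex_Icc a b)
    (fun x hx => (hf x hx).continuousAt.continuousWithinAt)
    (fun x hx => (hf x (interior_subset hx)).hasDerivWithinAt)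
    (fun x hx => hf' x (interior_subset hx)) (left_mem_Icc.2 hab) (right_mem_Icc.2 hab) hab

/-- A function with nonpositive derivative on `[a, b]` satisfies `f b ≤ f a`. -/
theorem le_of_hasDerivAt_nonpos {f f' : ℝ → ℝ} {a b : ℝ} (hab : a ≤ b)
    (hf : ∀ x ∈ Icc a b, HasDerivAt f (f' x) x) (hf' : ∀ x ∈ Icc a b, f' x ≤ 0) : f b ≤ f a := by
  have := le_of_hasDerivAt_nonneg (f := fun x => -f x) (f' := fun x => -f' x) hab
    (fun x hx => (hf x hx).neg) (fun x hx => neg_nonneg.2 (hf' x hx))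
  exact neg_le_neg_iff.1 this

theorem integrable_exp_neg_sq_div_two : Integrable fun u : ℝ => Real.exp (-(u ^ 2) / 2) := by
  have := integrable_exp_neg_mul_sq (b := 1 / 2) (by norm_num)
  refine this.congr (ae_of_all _ fun x => ?_)
  ring_nf

/-- The unnormalized Gaussian distribution function. -/
noncomputable def gaussInt (x : ℝ) : ℝ := ∫ u in Iic x, Real.exp (-(u ^ 2) / 2)

theorem hasDerivAt_gaussInt (x : ℝ) : HasDerivAt gaussInt (Real.exp (-(x ^ 2) / 2)) x := by
  have hc : Continuous fun u : ℝ => Real.exp (-(u ^ 2) / 2) := by fun_prop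
  have h := (intervalIntegral.integral_hasDerivAt_right (hc.intervalIntegrable 0 x)
    (hc.stronglyMeasurableAtFilter _ _) hc.continuousAt).const_add (gaussInt 0)
  refine h.congr_of_eventuallyEq (Eventually.of_forall fun t => ?_)
  have := intervalIntegral.integral_Iic_sub_Iic (μ := volume) (a := 0) (b := t)
    integrable_exp_neg_sq_div_two.integrableOn integrable_exp_neg_sq_div_two.integrableOn
  simp only [← this, gaussInt]
  ring

theorem gaussInt_nonneg (x : ℝ) : 0 ≤ gaussInt x :=
  integral_nonneg fun _ => (Real.exp_pos _).le

theorem gaussInt_le (x : ℝ) : gaussInt x ≤ Real.sqrt (2 * π) := by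
  have h : ∫ u : ℝ, Real.exp (-(u ^ 2) / 2) = Real.sqrt (2 * π) := by
    have := integral_gaussian (1 / 2)
    rw [show π / (1 / 2) = 2 * π by ring] at this
    rw [← this]
    congr 1 with u
    ring_nf
  rw [← h]
  exact setIntegral_le_integral integrable_exp_neg_sq_div_two
    (ae_of_all _ fun _ => (Real.exp_pos _).le)

theorem hasDerivAt_exp_neg_sq_div_two (x : ℝ) :
    HasDerivAt (fun u : ℝ => Real.exp (-(u ^ 2) / 2)) (-x * Real.exp (-(x ^ 2) / 2)) x := by
  have h := (((hasDerivAt_id x).pow 2).neg.div_const 2).exp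
  refine h.congr_deriv ?_
  simp
  ring

/-- Mills-ratio bound: `gaussInt x + x / (1 + x²) e^{-x²/2}` is monotone. -/
theorem gaussInt_add_mills_le {a b : ℝ} (hab : a ≤ b) :
    gaussInt a + a / (1 + a ^ 2) * Real.exp (-(a ^ 2) / 2) ≤
      gaussInt b + b / (1 + b ^ 2) * Real.exp (-(b ^ 2) / 2) := by
  refine le_of_hasDerivAt_nonneg
    (f := fun x => gaussInt x + x / (1 + x ^ 2) * Real.exp (-(x ^ 2) / 2))
    (f' := fun x => 2 / (1 + x ^ 2) ^ 2 * Real.exp (-(x ^ 2) / 2)) hab (fun x _ => ?_)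
    (fun x _ => by positivity)
  have h0 : (1 + x ^ 2) ≠ 0 := by positivity
  have h := (hasDerivAt_gaussInt x).add
    (((hasDerivAt_id x).div (((hasDerivAt_id x).pow 2).const_add 1) h0).mul
      (hasDerivAt_exp_neg_sq_div_two x))
  refine h.congr_deriv ?_
  simp
  field_simp
  ring

theorem tendsto_mills_atTop :
    Tendsto (fun x : ℝ => x / (1 + x ^ 2) * Real.exp (-(x ^ 2) / 2)) atTop (𝓝 0) := by
  have h0 : Tendsto (fun x : ℝ => x⁻¹) atTop (𝓝 0) := tendsto_inv_atTop_zero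
  refine tendsto_of_tendsto_of_tendsto_of_le_of_le' tendsto_const_nhds h0 ?_ ?_
  · filter_upwards [eventually_gt_atTop 0] with x hx
    positivity
  · filter_upwards [eventually_gt_atTop 0] with x hx
    have h1 : x / (1 + x ^ 2) ≤ x⁻¹ := by
      rw [inv_eq_one_div, div_le_div_iff₀ (by positivity) hx]
      nlinarith
    have h2 : Real.exp (-(x ^ 2) / 2) ≤ 1 := Real.exp_le_one_iff.2 (by nlinarith [sq_nonneg x])
    calc _ ≤ x⁻¹ * 1 := by gcongr
      _ = x⁻¹ := mul_one _

theorem hasDerivAt_pow_three_mul_exp (x : ℝ) :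
    HasDerivAt (fun u : ℝ => u ^ 3 * Real.exp (-(u ^ 2) / 2))
      (x ^ 2 * (3 - x ^ 2) * Real.exp (-(x ^ 2) / 2)) x := by
  have h := ((hasDerivAt_id x).pow 3).mul (hasDerivAt_exp_neg_sq_div_two x)
  refine h.congr_deriv ?_
  simp
  ring

theorem pow_three_mul_exp_le {a b : ℝ} (ha : 0 ≤ a) (hab : a ≤ b) (hb : b ^ 2 ≤ 3) :
    a ^ 3 * Real.exp (-(a ^ 2) / 2) ≤ b ^ 3 * Real.exp (-(b ^ 2) / 2) := by
  refine le_of_hasDerivAt_nonneg hab (fun x _ => hasDerivAt_pow_three_mul_exp x) fun x hx => ?_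
  have : 0 ≤ 3 - x ^ 2 := by nlinarith [hx.1, hx.2]
  positivity

theorem pow_three_mul_exp_ge {a b : ℝ} (ha : 0 ≤ a) (hab : a ≤ b) (ha3 : 3 ≤ a ^ 2) :
    b ^ 3 * Real.exp (-(b ^ 2) / 2) ≤ a ^ 3 * Real.exp (-(a ^ 2) / 2) := by
  refine le_of_hasDerivAt_nonpos hab (fun x _ => hasDerivAt_pow_three_mul_exp x) fun x hx => ?_
  have : 0 ≤ x ^ 2 - 3 := by nlinarith [hx.1, hx.2]
  have : 0 ≤ x ^ 2 * (x ^ 2 - 3) * Real.exp (-(x ^ 2) / 2) := by positivity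
  linarith

/-- Tangent bound at `w = y` from below, in the variable `w⁻²`. -/
theorem gaussInt_lower {y w : ℝ} (hy0 : 0 < y) (hy1 : y ≤ 1) (hw : 0 < w) :
    gaussInt y + y / 2 * Real.exp (-(y ^ 2) / 2) * (1 - y ^ 2 / w ^ 2) ≤ gaussInt w := by
  set c := y ^ 3 * Real.exp (-(y ^ 2) / 2) with hc
  have hcpos : 0 < c := by positivity
  have hder : ∀ x : ℝ, 0 < x → HasDerivAt (fun x => gaussInt x + c / 2 / x ^ 2)
      ((x ^ 3 * Real.exp (-(x ^ 2) / 2) - c) / x ^ 3) x := by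
    intro x hx
    have h := (hasDerivAt_gaussInt x).add
      ((hasDerivAt_const x (c / 2)).div ((hasDerivAt_id x).pow 2) (pow_pos hx 2).ne')
    refine h.congr_deriv ?_
    simp
    field_simp
    ring
  have hyval : c / 2 / y ^ 2 = y / 2 * Real.exp (-(y ^ 2) / 2) := by
    rw [hc]; field_simp
  have hwval : c / 2 / w ^ 2 = y / 2 * Real.exp (-(y ^ 2) / 2) * (y ^ 2 / w ^ 2) := by
    rw [hc]; field_simp
  suffices gaussInt y + c / 2 / y ^ 2 ≤ gaussInt w + c / 2 / w ^ 2 by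
    rw [hyval, hwval] at this
    linarith
  have hy2 : y ^ 2 ≤ 1 := by nlinarith
  rcases le_total w y with hwy | hyw
  · refine le_of_hasDerivAt_nonpos (f := fun x => gaussInt x + c / 2 / x ^ 2) hwy
      (fun x hx => hder x (hw.trans_le hx.1)) fun x hx => ?_
    have hx0 := hw.trans_le hx.1
    have := pow_three_mul_exp_le hx0.le hx.2 (by linarith)
    exact div_nonpos_of_nonpos_of_nonneg (by linarith) (by positivity)
  rcases le_or_gt c (w ^ 3 * Real.exp (-(w ^ 2) / 2)) with hm | hm
  · refine le_of_hasDerivAt_nonneg (f := fun x => gaussInt x + c / 2 / x ^ 2) hyw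
      (fun x hx => hder x (hy0.trans_le hx.1)) fun x hx => ?_
    have hx0 := hy0.trans_le hx.1
    have : c ≤ x ^ 3 * Real.exp (-(x ^ 2) / 2) := by
      rcases le_total (x ^ 2) 3 with h3 | h3
      · exact pow_three_mul_exp_le hy0.le hx.1 h3
      · exact hm.trans (pow_three_mul_exp_ge hx0.le hx.2 h3)
    exact div_nonneg (by linarith) (by positivity)
  · have hw3 : 3 ≤ w ^ 2 := by
      by_contra! h
      exact hm.not_ge (pow_three_mul_exp_le hy0.le hyw h.le)
    have hlim := (tendsto_mills_atTop.const_sub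
      (gaussInt y + y / (1 + y ^ 2) * Real.exp (-(y ^ 2) / 2)))
    rw [sub_zero] at hlim
    have hle : gaussInt y + y / (1 + y ^ 2) * Real.exp (-(y ^ 2) / 2) ≤
        gaussInt w + c / 2 / w ^ 2 := by
      refine le_of_tendsto hlim ?_
      filter_upwards [eventually_ge_atTop w] with X hX
      have h1 := gaussInt_add_mills_le (hyw.trans hX)
      have h2 := le_of_hasDerivAt_nonpos (f := fun x => gaussInt x + c / 2 / x ^ 2) hX
        (fun x hx => hder x (hw.trans_le hx.1)) fun x hx => by
          have hx0 := hw.trans_le hx.1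
          have := pow_three_mul_exp_ge hw.le hx.1 hw3
          exact div_nonpos_of_nonpos_of_nonneg (by linarith) (by positivity)
      have h3 : 0 ≤ c / 2 / X ^ 2 := by positivity
      linarith
    refine le_trans ?_ hle
    rw [hyval]
    gcongr
    linarith

/-- Tangent bound at `w = y` from above, in the variable `w²`. -/
theorem gaussInt_upper {y w : ℝ} (hy0 : 0 < y) (hw : 0 < w) :
    gaussInt w ≤ gaussInt y + y / 2 * Real.exp (-(y ^ 2) / 2) * (w ^ 2 / y ^ 2 - 1) := by
  set e := Real.exp (-(y ^ 2) / 2) with he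
  have hepos : 0 < e := Real.exp_pos _
  have hder : ∀ x : ℝ, HasDerivAt (fun x => gaussInt x - e / (2 * y) * x ^ 2)
      (Real.exp (-(x ^ 2) / 2) - e * (x / y)) x := by
    intro x
    have h := (hasDerivAt_gaussInt x).sub (((hasDerivAt_id x).pow 2).const_mul (e / (2 * y)))
    refine h.congr_deriv ?_
    simp
    field_simp
  suffices gaussInt w - e / (2 * y) * w ^ 2 ≤ gaussInt y - e / (2 * y) * y ^ 2 by
    have h1 : y / 2 * e * (w ^ 2 / y ^ 2 - 1) = e / (2 * y) * w ^ 2 - e / (2 * y) * y ^ 2 := by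
      field_simp
    linarith
  rcases le_total w y with hwy | hyw
  · refine le_of_hasDerivAt_nonneg (f := fun x => gaussInt x - e / (2 * y) * x ^ 2) hwy
      (fun x _ => hder x) fun x hx => ?_
    have hx0 := hw.trans_le hx.1
    have h1 : e ≤ Real.exp (-(x ^ 2) / 2) := Real.exp_le_exp.2 (by nlinarith [hx.2])
    have h2 : x / y ≤ 1 := (div_le_one hy0).2 hx.2
    nlinarith
  · refine le_of_hasDerivAt_nonpos (f := fun x => gaussInt x - e / (2 * y) * x ^ 2) hyw
      (fun x _ => hder x) fun x hx => ?_
    have h1 : Real.exp (-(x ^ 2) / 2) ≤ e := Real.exp_le_exp.2 (by nlinarith [hx.1])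
    have h2 : 1 ≤ x / y := (one_le_div hy0).2 hx.1
    nlinarith

/-! ### The Student distribution as a scale mixture of Gaussians -/

theorem integrableOn_rpow_mul_exp_neg_mul {a r : ℝ} (ha : 0 < a) (hr : 0 < r) :
    IntegrableOn (fun s : ℝ => s ^ (a - 1) * Real.exp (-(r * s))) (Ioi 0) := by
  have h := integrableOn_rpow_mul_exp_neg_mul_rpow (s := a - 1) (p := 1) (b := r)
    (by linarith) one_pos hr
  simpa using h

/-- The density of the Gamma distribution with shape and rate both equal to `b`. -/
noncomputable def mixWeight (b s : ℝ) : ℝ :=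
  b ^ b / Real.Gamma b * (s ^ (b - 1) * Real.exp (-(b * s)))

theorem mixWeight_nonneg {b s : ℝ} (hb : 0 < b) (hs : 0 < s) : 0 ≤ mixWeight b s := by
  have := Real.Gamma_pos_of_pos hb
  unfold mixWeight
  positivity

theorem measurable_mixWeight (b : ℝ) : Measurable (mixWeight b) := by
  unfold mixWeight
  fun_prop

/-- Moments of the mixing density. -/
theorem mixWeight_moment {b p : ℝ} (hb : 0 < b) (hp : 0 < b + p) :
    IntegrableOn (fun s => mixWeight b s * s ^ p) (Ioi 0) ∧
      ∫ s in Ioi (0 : ℝ), mixWeight b s * s ^ p = Real.Gamma (b + p) / Real.Gamma b / b ^ p := by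
  have heq : EqOn (fun s => b ^ b / Real.Gamma b * (s ^ (b + p - 1) * Real.exp (-(b * s))))
      (fun s => mixWeight b s * s ^ p) (Ioi 0) := by
    intro s hs
    have hs : 0 < s := hs
    simp only [mixWeight]
    rw [show b + p - 1 = (b - 1) + p by ring, Real.rpow_add hs]
    ring
  refine ⟨IntegrableOn.congr_fun ((integrableOn_rpow_mul_exp_neg_mul hp hb).const_mul _) heq
    measurableSet_Ioi, ?_⟩
  rw [← setIntegral_congr_fun measurableSet_Ioi heq, integral_const_mul,
    Real.integral_rpow_mul_exp_neg_mul_Ioi hp hb, one_div, Real.inv_rpow hb.le,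
    Real.rpow_add hb]
  have := (Real.rpow_pos_of_pos hb b).ne'
  have := (Real.rpow_pos_of_pos hb p).ne'
  field_simp

theorem integrableOn_mixWeight {b : ℝ} (hb : 0 < b) : IntegrableOn (mixWeight b) (Ioi 0) := by
  simpa using (mixWeight_moment (p := 0) hb (by simpa)).1

theorem integral_mixWeight {b : ℝ} (hb : 0 < b) : ∫ s in Ioi (0 : ℝ), mixWeight b s = 1 := by
  simpa [(Real.Gamma_pos_of_pos hb).ne'] using (mixWeight_moment (p := 0) hb (by simpa)).2

theorem integrableOn_mixWeight_mul {b : ℝ} (hb : 0 < b) :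
    IntegrableOn (fun s => mixWeight b s * s) (Ioi 0) := by
  simpa using (mixWeight_moment (p := 1) hb (by linarith)).1

theorem integral_mixWeight_mul {b : ℝ} (hb : 0 < b) :
    ∫ s in Ioi (0 : ℝ), mixWeight b s * s = 1 := by
  have h := (mixWeight_moment (p := 1) hb (by linarith)).2
  rw [Real.Gamma_add_one hb.ne'] at h
  simpa [(Real.Gamma_pos_of_pos hb).ne', hb.ne'] using h

theorem integrableOn_mixWeight_mul_inv {b : ℝ} (hb : 1 < b) :
    IntegrableOn (fun s => mixWeight b s * s⁻¹) (Ioi 0) := by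
  simpa [Real.rpow_neg_one] using
    (mixWeight_moment (b := b) (p := -1) (by linarith) (by linarith)).1

theorem integral_mixWeight_mul_inv {b : ℝ} (hb : 1 < b) :
    ∫ s in Ioi (0 : ℝ), mixWeight b s * s⁻¹ = b / (b - 1) := by
  have h := (mixWeight_moment (b := b) (p := -1) (by linarith) (by linarith)).2
  have h0 : b - 1 ≠ 0 := by linarith
  have h1 := Real.Gamma_add_one h0
  have h2 := (Real.Gamma_pos_of_pos (show 0 < b - 1 by linarith)).ne'
  rw [sub_add_cancel] at h1
  simp only [Real.rpow_neg_one, ← sub_eq_add_neg] at h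
  rw [h, h1]
  field_simp

theorem integral_scaled_gaussian_Iic {s : ℝ} (hs : 0 < s) (t : ℝ) :
    ∫ x in Iic t, Real.sqrt s * Real.exp (-((x * Real.sqrt s) ^ 2) / 2) =
      gaussInt (t * Real.sqrt s) := by
  have h := integral_comp_mul_right_Ioi (fun u : ℝ => Real.exp (-(u ^ 2) / 2)) (-t)
    (Real.sqrt_pos.2 hs)
  have h1 := integral_comp_neg_Iic t fun x : ℝ => Real.exp (-((x * Real.sqrt s) ^ 2) / 2)
  have h2 := integral_comp_neg_Iic (t * Real.sqrt s) fun x : ℝ => Real.exp (-(x ^ 2) / 2)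
  simp only [neg_mul, neg_sq] at h h1 h2
  rw [integral_const_mul, gaussInt, h1, h, h2, smul_eq_mul, mul_inv_cancel_left₀
    (Real.sqrt_pos.2 hs).ne']

/-- The Student density is a mixture of centred Gaussian densities. -/
theorem tDensity_eq_mixture {v : ℝ} (hv : 0 < v) (x : ℝ) :
    tDensity v x = 1 / Real.sqrt (2 * π) * ∫ s in Ioi (0 : ℝ), mixWeight (v / 2) s *
      (Real.sqrt s * Real.exp (-((x * Real.sqrt s) ^ 2) / 2)) := by
  have hb : 0 < v / 2 := by positivity
  have hr : 0 < v / 2 * (1 + x ^ 2 / v) := by positivity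
  have ha : 0 < (v + 1) / 2 := by positivity
  have heq : EqOn (fun s => mixWeight (v / 2) s *
        (Real.sqrt s * Real.exp (-((x * Real.sqrt s) ^ 2) / 2)))
      (fun s => (v / 2) ^ (v / 2) / Real.Gamma (v / 2) *
        (s ^ ((v + 1) / 2 - 1) * Real.exp (-(v / 2 * (1 + x ^ 2 / v) * s)))) (Ioi 0) := by
    intro s hs
    have hs : 0 < s := hs
    simp only [mixWeight]
    rw [show (v + 1) / 2 - 1 = (v / 2 - 1) + 1 / 2 by ring, Real.rpow_add hs,
      ← Real.sqrt_eq_rpow, mul_pow, Real.sq_sqrt hs.le,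
      show -(v / 2 * (1 + x ^ 2 / v) * s) = -(v / 2 * s) + -(x ^ 2 * s) / 2 by
        field_simp; ring, Real.exp_add]
    ring
  rw [setIntegral_congr_fun measurableSet_Ioi heq, integral_const_mul,
    Real.integral_rpow_mul_exp_neg_mul_Ioi ha hr, one_div (v / 2 * _), Real.inv_rpow hr.le,
    Real.mul_rpow hb.le (by positivity), tDensity, Real.rpow_neg (by positivity)]
  have h1 : (v / 2) ^ ((v + 1) / 2) = (v / 2) ^ (v / 2) * Real.sqrt (v / 2) := by
    rw [Real.sqrt_eq_rpow, ← Real.rpow_add hb]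
    ring_nf
  have h2 : Real.sqrt (v * π) = Real.sqrt (2 * π) * Real.sqrt (v / 2) := by
    rw [← Real.sqrt_mul (by positivity)]
    ring_nf
  rw [h1, h2]
  have := (Real.rpow_pos_of_pos hb (v / 2)).ne'
  have := (Real.rpow_pos_of_pos (show 0 < 1 + x ^ 2 / v by positivity) ((v + 1) / 2)).ne'
  have := (Real.Gamma_pos_of_pos hb).ne'
  have := (Real.sqrt_pos.2 hb).ne'
  have := (Real.sqrt_pos.2 (show 0 < 2 * π by positivity)).ne'
  simp only [mul_inv]
  set P := (v / 2) ^ (v / 2)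
  set Q := (1 + x ^ 2 / v) ^ ((v + 1) / 2)
  set R := Real.sqrt (v / 2)
  set G := Real.Gamma (v / 2)
  field_simp

theorem continuous_gaussInt : Continuous gaussInt :=
  continuous_iff_continuousAt.2 fun x => (hasDerivAt_gaussInt x).continuousAt

theorem integrableOn_mixWeight_mul_gaussInt {b : ℝ} (hb : 0 < b) (t : ℝ) :
    IntegrableOn (fun s => mixWeight b s * gaussInt (t * Real.sqrt s)) (Ioi 0) := by
  refine ((integrableOn_mixWeight hb).mul_const (Real.sqrt (2 * π))).mono' ?_ ?_
  · exact ((measurable_mixWeight b).mul (continuous_gaussInt.measurable.comp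
      (by fun_prop))).aestronglyMeasurable
  · filter_upwards [ae_restrict_mem measurableSet_Ioi] with s hs
    have h := mixWeight_nonneg hb hs
    rw [Real.norm_of_nonneg (mul_nonneg h (gaussInt_nonneg _))]
    exact mul_le_mul_of_nonneg_left (gaussInt_le _) h

/-- The Student distribution function as a mixture of Gaussian distribution functions. -/
theorem tCDF_eq_mixture {v : ℝ} (hv : 0 < v) (t : ℝ) :
    tCDF v t = 1 / Real.sqrt (2 * π) *
      ∫ s in Ioi (0 : ℝ), mixWeight (v / 2) s * gaussInt (t * Real.sqrt s) := by
  have hb : 0 < v / 2 := by positivity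
  set F : ℝ → ℝ → ℝ := fun x s => mixWeight (v / 2) s *
    (Real.sqrt s * Real.exp (-((x * Real.sqrt s) ^ 2) / 2)) with hF
  have hinner : ∀ s ∈ Ioi (0 : ℝ), ∫ x in Iic t, F x s =
      mixWeight (v / 2) s * gaussInt (t * Real.sqrt s) := fun s hs => by
    simp only [hF]
    rw [integral_const_mul, integral_scaled_gaussian_Iic hs]
  have hmeas : Measurable (Function.uncurry F) := by
    have := measurable_mixWeight (v / 2)
    simp only [hF, Function.uncurry_def]
    fun_prop
  have hint : Integrable (Function.uncurry F)
      ((volume.restrict (Iic t)).prod (volume.restrict (Ioi (0 : ℝ)))) := by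
    rw [integrable_prod_iff' hmeas.aestronglyMeasurable]
    constructor
    · filter_upwards [ae_restrict_mem measurableSet_Ioi] with s hs
      have hs : 0 < s := hs
      have h := integrable_exp_neg_mul_sq (b := s / 2) (by positivity)
      refine (((h.const_mul (Real.sqrt s)).const_mul (mixWeight (v / 2) s)).congr
        (ae_of_all _ fun x => ?_)).integrableOn
      simp only [hF, Function.uncurry, mul_pow, Real.sq_sqrt hs.le]
      ring_nf
    · refine (integrableOn_mixWeight_mul_gaussInt hb t).congr_fun (fun s hs => ?_)
        measurableSet_Ioi
      simp only
      rw [← hinner s hs]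
      refine integral_congr_ae (ae_of_all _ fun x => ?_)
      have := mixWeight_nonneg hb hs
      exact (Real.norm_of_nonneg (show 0 ≤ F x s by simp only [hF]; positivity)).symm
  calc tCDF v t = ∫ x in Iic t, 1 / Real.sqrt (2 * π) * ∫ s in Ioi (0 : ℝ), F x s := by
        simp only [tCDF, tDensity_eq_mixture hv, hF]
    _ = 1 / Real.sqrt (2 * π) * ∫ s in Ioi (0 : ℝ), ∫ x in Iic t, F x s := by
        rw [integral_const_mul, integral_integral_swap hint]
    _ = _ := by rw [setIntegral_congr_fun measurableSet_Ioi hinner]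

theorem Φ_eq (y : ℝ) : Φ y = 1 / Real.sqrt (2 * π) * gaussInt y := rfl

theorem sq_scaled {v y s : ℝ} (hv : 2 < v) (hs : 0 < s) :
    (y * Real.sqrt (v / (v - 2)) * Real.sqrt s) ^ 2 = y ^ 2 * (v / (v - 2) * s) := by
  have : 0 < v - 2 := by linarith
  rw [mul_pow, mul_pow, Real.sq_sqrt (by positivity), Real.sq_sqrt hs.le]
  ring

theorem le_J {v y : ℝ} (hv : 2 < v) (hy0 : 0 < y) (hy1 : y ≤ 1) : 2 * Φ y - 1 ≤ J v y := by
  have hv2 : 0 < v - 2 := by linarith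
  have hb : 0 < v / 2 := by linarith
  have hb1 : 1 < v / 2 := by linarith
  set k := y / 2 * Real.exp (-(y ^ 2) / 2) with hk
  have hle : gaussInt y ≤ ∫ s in Ioi (0 : ℝ), mixWeight (v / 2) s *
      gaussInt (y * Real.sqrt (v / (v - 2)) * Real.sqrt s) := by
    have hI1 := (integrableOn_mixWeight hb).const_mul (gaussInt y + k)
    have hI2 := (integrableOn_mixWeight_mul_inv hb1).const_mul (k * ((v - 2) / v))
    have hval : ∫ s in Ioi (0 : ℝ), ((gaussInt y + k) * mixWeight (v / 2) s -
        k * ((v - 2) / v) * (mixWeight (v / 2) s * s⁻¹)) = gaussInt y := by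
      rw [integral_sub hI1 hI2, integral_const_mul, integral_const_mul, integral_mixWeight hb,
        integral_mixWeight_mul_inv hb1]
      have : v / 2 - 1 ≠ 0 := by linarith
      field_simp
      ring
    rw [← hval]
    refine setIntegral_mono_on (hI1.sub hI2) (integrableOn_mixWeight_mul_gaussInt hb _)
      measurableSet_Ioi fun s hs => ?_
    have hs : 0 < s := hs
    have hw : 0 < y * Real.sqrt (v / (v - 2)) * Real.sqrt s := by positivity
    have h := mul_le_mul_of_nonneg_left (gaussInt_lower hy0 hy1 hw) (mixWeight_nonneg hb hs)
    rw [sq_scaled hv hs] at h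
    refine le_of_eq_of_le ?_ h
    rw [← hk]
    field_simp
    ring
  have hJ : J v y = 2 * (1 / Real.sqrt (2 * π) * ∫ s in Ioi (0 : ℝ), mixWeight (v / 2) s *
      gaussInt (y * Real.sqrt (v / (v - 2)) * Real.sqrt s)) - 1 := by
    rw [J, tCDF_eq_mixture (by linarith)]
  rw [hJ, Φ_eq]
  gcongr

theorem J_le {v y : ℝ} (hv : 2 < v) (hy0 : 0 < y) :
    J v y ≤ 2 * (1 / Real.sqrt (2 * π) *
      (gaussInt y + y / 2 * Real.exp (-(y ^ 2) / 2) * (2 / (v - 2)))) - 1 := by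
  have hv2 : 0 < v - 2 := by linarith
  have hb : 0 < v / 2 := by linarith
  set k := y / 2 * Real.exp (-(y ^ 2) / 2) with hk
  have hle : ∫ s in Ioi (0 : ℝ), mixWeight (v / 2) s *
      gaussInt (y * Real.sqrt (v / (v - 2)) * Real.sqrt s) ≤ gaussInt y + k * (2 / (v - 2)) := by
    have hI1 := (integrableOn_mixWeight hb).const_mul (gaussInt y - k)
    have hI2 := (integrableOn_mixWeight_mul hb).const_mul (k * (v / (v - 2)))
    have hval : ∫ s in Ioi (0 : ℝ), ((gaussInt y - k) * mixWeight (v / 2) s +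
        k * (v / (v - 2)) * (mixWeight (v / 2) s * s)) = gaussInt y + k * (2 / (v - 2)) := by
      rw [integral_add hI1 hI2, integral_const_mul, integral_const_mul, integral_mixWeight hb,
        integral_mixWeight_mul hb]
      field_simp
      ring
    rw [← hval]
    refine setIntegral_mono_on (integrableOn_mixWeight_mul_gaussInt hb _) (hI1.add hI2)
      measurableSet_Ioi fun s hs => ?_
    have hs : 0 < s := hs
    have hw : 0 < y * Real.sqrt (v / (v - 2)) * Real.sqrt s := by positivity
    have h := mul_le_mul_of_nonneg_left (gaussInt_upper hy0 hw) (mixWeight_nonneg hb hs)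
    rw [sq_scaled hv hs] at h
    refine le_of_le_of_eq h ?_
    rw [← hk]
    field_simp
    ring
  rw [J, tCDF_eq_mixture (by linarith)]
  gcongr

theorem stmt_16 (y : ℝ) (hy0 : 0 < y) (hy1 : y ≤ 1) :
    sInf {p : ℝ | ∃ v : ℕ, 3 ≤ v ∧ p = J v y} = 2 * Φ y - 1 := by
  have hlow : 2 * Φ y - 1 ∈ lowerBounds {p : ℝ | ∃ v : ℕ, 3 ≤ v ∧ p = J v y} := by
    rintro _ ⟨v, hv, rfl⟩
    have : (3 : ℝ) ≤ v := by exact_mod_cast hv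
    exact le_J (by linarith) hy0 hy1
  refine le_antisymm ?_ (le_csInf ⟨_, 3, le_rfl, rfl⟩ hlow)
  have hz : Tendsto (fun v : ℕ => (2 : ℝ) / ((v : ℝ) - 2)) atTop (𝓝 0) :=
    (tendsto_atTop_add_const_right _ (-2) tendsto_natCast_atTop_atTop).const_div_atTop 2
  have hlim := ((((hz.const_mul (y / 2 * Real.exp (-(y ^ 2) / 2))).const_add
    (gaussInt y)).const_mul (1 / Real.sqrt (2 * π))).const_mul 2).sub_const 1
  rw [mul_zero, add_zero, ← Φ_eq] at hlim
  refine ge_of_tendsto hlim ?_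
  filter_upwards [eventually_ge_atTop 3] with v hv
  have : (3 : ℝ) ≤ v := by exact_mod_cast hv
  exact (csInf_le ⟨_, hlow⟩ ⟨v, hv, rfl⟩).trans (J_le (by linarith) hy0)
end

section
/- Let y be a real number with 0 < y ≤ 1. Then the infimum over integers v ≥ 3 of 1 − J_v(y) = 2 − 2·F_v(y·√(v/(v−2))) equals the minimum of the two values 2 − 2·F_3(y·√3) and 2 − 2·F_4(y·√2). Equivalently, the infimum over integers v ≥ 3 of the probability P(|X_v| ≥ y·√(v/(v−2))) for a t-distributed random variable X_v equals min over v ∈ {3,4} of 2 − 2·F_v(y·√(v/(v−2))). -/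
open MeasureTheory Real

lemma integrable_one_add_sq_rpow_neg {a : ℝ} (ha : 1 / 2 < a) :
    Integrable (fun x : ℝ => (1 + x ^ 2) ^ (-a)) := by
  have h := integrable_rpow_neg_one_add_norm_sq (E := ℝ) (μ := volume) (r := 2 * a)
    (by simp; linarith)
  refine h.congr (Filter.Eventually.of_forall fun x => ?_)
  simp only [Real.norm_eq_abs, sq_abs]
  congr 1
  ring

lemma lintegral_rpow_mul_exp_neg_mul_Ioi {a r : ℝ} (ha : 0 < a) (hr : 0 < r) :
    ∫⁻ u in Set.Ioi (0 : ℝ), ENNReal.ofReal (u ^ (a - 1) * rexp (-(r * u)))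
      = ENNReal.ofReal ((1 / r) ^ a * Real.Gamma a) := by
  have h := integral_rpow_mul_exp_neg_mul_Ioi ha hr
  have hpos : 0 < (1 / r) ^ a * Real.Gamma a :=
    mul_pos (rpow_pos_of_pos (by positivity) _) (Gamma_pos_of_pos ha)
  rw [← h, ofReal_integral_eq_lintegral_ofReal]
  · exact Integrable.of_integral_ne_zero (by rw [h]; exact hpos.ne')
  · refine (ae_restrict_mem measurableSet_Ioi).mono fun u hu => ?_
    exact mul_nonneg (rpow_nonneg (le_of_lt hu) _) (exp_pos _).le

lemma lintegral_exp_neg_one_add_sq_mul (a : ℝ) {u : ℝ} (hu : 0 < u) :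
    ∫⁻ x : ℝ, ENNReal.ofReal (u ^ (a - 1) * rexp (-((1 + x ^ 2) * u)))
      = ENNReal.ofReal (√π) * ENNReal.ofReal (u ^ (a - 1 / 2 - 1) * rexp (-(1 * u))) := by
  have hfun : ∀ x : ℝ, u ^ (a - 1) * rexp (-((1 + x ^ 2) * u))
      = (u ^ (a - 1) * rexp (-u)) * rexp (-u * x ^ 2) := by
    intro x
    rw [mul_assoc, ← Real.exp_add]
    ring_nf
  simp_rw [hfun]
  rw [← ofReal_integral_eq_lintegral_ofReal ((integrable_exp_neg_mul_sq hu).const_mul _)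
    (Filter.Eventually.of_forall fun x => by positivity), integral_const_mul, integral_gaussian,
    ← ENNReal.ofReal_mul (sqrt_nonneg _)]
  congr 1
  have hs : u ^ (a - 1 / 2 - 1) = u ^ (a - 1) / √u := by
    rw [sqrt_eq_rpow, ← rpow_sub hu]
    ring_nf
  rw [sqrt_div pi_pos.le, hs, one_mul]
  ring

lemma integral_one_add_sq_rpow_neg {a : ℝ} (ha : 1 / 2 < a) :
    ∫ x : ℝ, (1 + x ^ 2) ^ (-a) = √π * Real.Gamma (a - 1 / 2) / Real.Gamma a := by
  have hG : 0 < Real.Gamma a := Gamma_pos_of_pos (by linarith)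
  have hG' : 0 < Real.Gamma (a - 1 / 2) := Gamma_pos_of_pos (by linarith)
  have hswap := lintegral_lintegral_swap (μ := (volume : Measure ℝ))
    (ν := (volume : Measure ℝ).restrict (Set.Ioi 0))
    (f := fun x u : ℝ => ENNReal.ofReal (u ^ (a - 1) * rexp (-((1 + x ^ 2) * u))))
    (by
      refine Measurable.aemeasurable ?_
      unfold Function.uncurry
      fun_prop)
  have hleft : ∀ x : ℝ,
      ∫⁻ u in Set.Ioi (0 : ℝ), ENNReal.ofReal (u ^ (a - 1) * rexp (-((1 + x ^ 2) * u)))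
        = ENNReal.ofReal (Real.Gamma a * (1 + x ^ 2) ^ (-a)) := by
    intro x
    have hx : 0 < 1 + x ^ 2 := by positivity
    rw [lintegral_rpow_mul_exp_neg_mul_Ioi (by linarith) hx, one_div, inv_rpow hx.le,
      ← rpow_neg hx.le, mul_comm]
  simp_rw [hleft] at hswap
  rw [setLIntegral_congr_fun measurableSet_Ioi
      (fun u hu => lintegral_exp_neg_one_add_sq_mul a hu),
    lintegral_const_mul _ (by fun_prop),
    lintegral_rpow_mul_exp_neg_mul_Ioi (by linarith) one_pos,
    ← ENNReal.ofReal_mul (sqrt_nonneg _),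
    ← ofReal_integral_eq_lintegral_ofReal ((integrable_one_add_sq_rpow_neg ha).const_mul _)
      (Filter.Eventually.of_forall fun x => by positivity),
    integral_const_mul, ENNReal.ofReal_eq_ofReal_iff] at hswap
  · rw [eq_div_iff hG.ne', mul_comm, hswap]
    simp
  · exact mul_nonneg hG.le (integral_nonneg fun x => by positivity)
  · simp only [one_div_one, one_rpow]
    positivity

lemma tDensity_eq_comp_div {v : ℝ} (hv : 0 < v) (x : ℝ) :
    tDensity v x = Real.Gamma ((v + 1) / 2) / (√(v * π) * Real.Gamma (v / 2)) *
      (1 + (x / √v) ^ 2) ^ (-((v + 1) / 2)) := by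
  rw [tDensity, div_pow, sq_sqrt hv.le]

lemma integrable_tDensity {v : ℝ} (hv : 0 < v) : Integrable (tDensity v) := by
  have h := ((integrable_one_add_sq_rpow_neg (a := (v + 1) / 2) (by linarith)).comp_div
    (sqrt_pos.2 hv).ne').const_mul (Real.Gamma ((v + 1) / 2) / (√(v * π) * Real.Gamma (v / 2)))
  exact h.congr (Filter.Eventually.of_forall fun x => (tDensity_eq_comp_div hv x).symm)

lemma integral_tDensity {v : ℝ} (hv : 0 < v) : ∫ x, tDensity v x = 1 := by
  simp_rw [tDensity_eq_comp_div hv]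
  rw [integral_const_mul,
    Measure.integral_comp_div (fun x : ℝ => (1 + x ^ 2) ^ (-((v + 1) / 2))) (√v),
    integral_one_add_sq_rpow_neg (by linarith), abs_of_nonneg (sqrt_nonneg _), smul_eq_mul,
    sqrt_mul hv.le, show (v + 1) / 2 - 1 / 2 = v / 2 by ring]
  have h1 : 0 < Real.Gamma ((v + 1) / 2) := Gamma_pos_of_pos (by linarith)
  have h2 : 0 < Real.Gamma (v / 2) := Gamma_pos_of_pos (by linarith)
  have h3 : 0 < √v := sqrt_pos.2 hv
  have h4 : 0 < √π := sqrt_pos.2 pi_pos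
  field_simp

lemma tDensity_neg (v x : ℝ) : tDensity v (-x) = tDensity v x := by
  simp [tDensity]

lemma tCDF_eq_half_add {v : ℝ} (hv : 0 < v) (t : ℝ) :
    tCDF v t = 1 / 2 + ∫ x in (0 : ℝ)..t, tDensity v x := by
  have hi := integrable_tDensity hv
  have h1 := intervalIntegral.integral_Iic_sub_Iic (μ := volume) (a := 0) (b := t)
    hi.integrableOn hi.integrableOn
  have h2 := intervalIntegral.integral_Iic_add_Ioi (μ := volume) (b := 0)
    hi.integrableOn hi.integrableOn
  have h3 := integral_comp_neg_Iic 0 (tDensity v)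
  simp_rw [tDensity_neg, neg_zero] at h3
  rw [integral_tDensity hv] at h2
  rw [tCDF]
  linarith

/-- The normalising constant of the Student t density rescaled to variance one. -/
noncomputable def unitTConst (v : ℝ) : ℝ :=
  Real.Gamma ((v + 1) / 2) / (√((v - 2) * π) * Real.Gamma (v / 2))

/-- The Student t density rescaled to variance one. -/
noncomputable def unitTDensity (v x : ℝ) : ℝ :=
  unitTConst v * (1 + x ^ 2 / (v - 2)) ^ (-((v + 1) / 2))

lemma tCDF_mul_sqrt {v : ℝ} (hv : 2 < v) (y : ℝ) :
    tCDF v (y * √(v / (v - 2))) = 1 / 2 + ∫ x in (0 : ℝ)..y, unitTDensity v x := by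
  have hv0 : 0 < v := by linarith
  have hw : 0 < v - 2 := by linarith
  rw [tCDF_eq_half_add hv0]
  congr 1
  have h := intervalIntegral.mul_integral_comp_mul_left (a := 0) (b := y) (f := tDensity v)
    (√(v / (v - 2)))
  rw [mul_zero, mul_comm _ y] at h
  rw [← h, ← intervalIntegral.integral_const_mul]
  refine intervalIntegral.integral_congr fun x _ => ?_
  have h3 : 0 < √v := sqrt_pos.2 hv0
  have h4 : 0 < √(v - 2) := sqrt_pos.2 hw
  have hsq : (√(v / (v - 2)) * x) ^ 2 / v = x ^ 2 / (v - 2) := by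
    rw [mul_pow, sq_sqrt (by positivity)]
    field_simp
  simp only [tDensity, unitTDensity, unitTConst]
  rw [hsq, sqrt_div hv0.le, sqrt_mul hv0.le, sqrt_mul hw.le]
  have h2 : 0 < Real.Gamma (v / 2) := Gamma_pos_of_pos (by linarith)
  field_simp

lemma unitTConst_pos {v : ℝ} (hv : 2 < v) : 0 < unitTConst v := by
  have hw : 0 < v - 2 := by linarith
  have h1 : 0 < Real.Gamma ((v + 1) / 2) := Gamma_pos_of_pos (by linarith)
  have h2 : 0 < Real.Gamma (v / 2) := Gamma_pos_of_pos (by linarith)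
  rw [unitTConst]
  positivity

lemma continuous_unitTDensity {v : ℝ} (hv : 2 < v) : Continuous (unitTDensity v) := by
  have hw : 0 < v - 2 := by linarith
  unfold unitTDensity
  refine continuous_const.mul (Continuous.rpow_const (by fun_prop) fun x => Or.inl ?_)
  positivity

lemma unitTConst_add_two_sq {v : ℝ} (hv : 2 < v) :
    unitTConst (v + 2) ^ 2 = unitTConst v ^ 2 * ((v + 1) ^ 2 * (v - 2) / v ^ 3) := by
  have hv0 : 0 < v := by linarith
  have hw : 0 < v - 2 := by linarith
  have h2 : 0 < Real.Gamma (v / 2) := Gamma_pos_of_pos (by linarith)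
  have e1 : (v + 2 + 1) / 2 = (v + 1) / 2 + 1 := by ring
  have e2 : (v + 2) / 2 = v / 2 + 1 := by ring
  rw [unitTConst, unitTConst, e1, e2, Gamma_add_one (by positivity), Gamma_add_one (by positivity)]
  simp only [div_pow, mul_pow]
  rw [add_sub_cancel_right, sq_sqrt (by positivity), sq_sqrt (by positivity)]
  field_simp

lemma unitTConst_three : unitTConst 3 = 2 / π := by
  have h : Real.Gamma (3 / 2) = 1 / 2 * √π := by
    rw [show (3 / 2 : ℝ) = 1 / 2 + 1 by norm_num, Gamma_add_one (by norm_num), Gamma_one_half_eq]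
  rw [unitTConst, h, show ((3 : ℝ) + 1) / 2 = 2 by norm_num, Gamma_two,
    show ((3 : ℝ) - 2) * π = π by ring]
  have := mul_self_sqrt pi_pos.le
  rw [show √π * (1 / 2 * √π) = π / 2 by linarith]
  field_simp

lemma unitTConst_four_sq : unitTConst 4 ^ 2 = 9 / 32 := by
  have h : Real.Gamma (5 / 2) = 3 / 4 * √π := by
    rw [show (5 / 2 : ℝ) = 1 / 2 + 1 + 1 by norm_num, Gamma_add_one (by norm_num),
      Gamma_add_one (by norm_num), Gamma_one_half_eq]
    ring
  rw [unitTConst, show ((4 : ℝ) + 1) / 2 = 5 / 2 by norm_num, h,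
    show (4 : ℝ) / 2 = 2 by norm_num, Gamma_two, div_pow, mul_pow, mul_pow,
    sq_sqrt pi_pos.le, sq_sqrt (by positivity)]
  field_simp
  norm_num

lemma unitTConst_five_sq : unitTConst 5 ^ 2 = 64 / (27 * π ^ 2) := by
  have h := unitTConst_add_two_sq (v := 3) (by norm_num)
  rw [unitTConst_three] at h
  norm_num at h
  rw [h]
  field_simp
  norm_num

lemma unitTConst_sq_le (n : ℕ) : unitTConst (n + 6) ^ 2 ≤ 225 / 1024 := by
  induction n using Nat.twoStepInduction with
  | zero =>
    have h := unitTConst_add_two_sq (v := 4) (by norm_num)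
    rw [unitTConst_four_sq] at h
    norm_num at h ⊢
    rw [h]
  | one =>
    have h := unitTConst_add_two_sq (v := 5) (by norm_num)
    rw [unitTConst_five_sq] at h
    norm_num at h ⊢
    rw [h]
    have hp := pi_gt_d2
    have : 64 / (27 * π ^ 2) ≤ 64 / (27 * 3.14 ^ 2) := by gcongr
    norm_num at this ⊢
    linarith
  | more n ih _ =>
    have hn : (0 : ℝ) ≤ n := Nat.cast_nonneg n
    have h := unitTConst_add_two_sq (v := n + 6) (by linarith)
    have e : ((n + 2 : ℕ) : ℝ) + 6 = n + 6 + 2 := by push_cast; ring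
    rw [e, h]
    refine (mul_le_of_le_one_right (sq_nonneg _) ?_).trans ih
    rw [div_le_one (by positivity)]
    nlinarith

lemma unitTDensity_le_quadratic {v p q x : ℝ} (hv : 2 < v)
    (h : ∀ s : ℝ, 0 ≤ s → 1 ≤ (1 + (v + 1) / (2 * (v - 2)) * s) * (1 - p * s + q * s ^ 2)) :
    unitTDensity v x ≤ unitTConst v * (1 - p * x ^ 2 + q * x ^ 4) := by
  have hw : 0 < v - 2 := by linarith
  rw [unitTDensity]
  refine mul_le_mul_of_nonneg_left ?_ (unitTConst_pos hv).le
  have hs : 0 ≤ x ^ 2 / (v - 2) := by positivity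
  have hb := one_add_mul_self_le_rpow_one_add (s := x ^ 2 / (v - 2)) (by linarith)
    (p := (v + 1) / 2) (by linarith)
  rw [rpow_neg (by positivity)]
  have hk : 1 + (v + 1) / 2 * (x ^ 2 / (v - 2)) = 1 + (v + 1) / (2 * (v - 2)) * x ^ 2 := by
    field_simp
  rw [hk] at hb
  have hpos : 0 < 1 + (v + 1) / (2 * (v - 2)) * x ^ 2 := by positivity
  refine (inv_anti₀ hpos hb).trans ?_
  rw [inv_le_iff_one_le_mul₀' hpos]
  have hx := h (x ^ 2) (sq_nonneg x)
  rwa [← pow_mul] at hx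

lemma integral_unitTDensity_le {v p q : ℝ} (hv : 2 < v)
    (h : ∀ s : ℝ, 0 ≤ s → 1 ≤ (1 + (v + 1) / (2 * (v - 2)) * s) * (1 - p * s + q * s ^ 2)) :
    ∫ x in (0 : ℝ)..1, unitTDensity v x ≤ unitTConst v * (1 - p / 3 + q / 5) := by
  have hint : ∫ x in (0 : ℝ)..1, unitTConst v * (1 - p * x ^ 2 + q * x ^ 4)
      = unitTConst v * (1 - p / 3 + q / 5) := by
    rw [intervalIntegral.integral_const_mul, intervalIntegral.integral_add
      (Continuous.intervalIntegrable (by fun_prop) _ _)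
      (Continuous.intervalIntegrable (by fun_prop) _ _), intervalIntegral.integral_sub
      (Continuous.intervalIntegrable (by fun_prop) _ _)
      (Continuous.intervalIntegrable (by fun_prop) _ _)]
    simp only [intervalIntegral.integral_const_mul, integral_pow, intervalIntegral.integral_const]
    congr 1
    norm_num
    ring
  rw [← hint]
  exact intervalIntegral.integral_mono_on zero_le_one
    ((continuous_unitTDensity hv).intervalIntegrable _ _)
    (Continuous.intervalIntegrable (by fun_prop) _ _)
    fun x _ => unitTDensity_le_quadratic hv h

lemma unitTDensity_three (x : ℝ) : unitTDensity 3 x = 2 / π * ((1 + x ^ 2) ^ 2)⁻¹ := by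
  rw [unitTDensity, unitTConst_three, show (3 : ℝ) - 2 = 1 by norm_num, div_one,
    show -((3 + 1) / 2 : ℝ) = -(2 : ℕ) by norm_num, rpow_neg (by positivity), rpow_natCast]

lemma integral_unitTDensity_three : ∫ x in (0 : ℝ)..1, unitTDensity 3 x = 1 / 4 + 1 / (2 * π) := by
  have hd : ∀ x ∈ Set.uIcc (0 : ℝ) 1,
      HasDerivAt (fun x => 2 / π * ((x / (1 + x ^ 2) + arctan x) / 2)) (unitTDensity 3 x) x := by
    intro x _
    have hx : 1 + x ^ 2 ≠ 0 := by positivity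
    have h1 : HasDerivAt (fun x : ℝ => 1 + x ^ 2) (2 * x) x := by
      simpa using (hasDerivAt_pow 2 x).const_add 1
    have h2 := ((((hasDerivAt_id x).div h1 hx).add (hasDerivAt_arctan x)).div_const 2).const_mul
      (2 / π)
    refine h2.congr_deriv ?_
    rw [unitTDensity_three]
    simp only [id]
    field_simp
    ring
  rw [intervalIntegral.integral_eq_sub_of_hasDerivAt hd
    ((continuous_unitTDensity (by norm_num)).intervalIntegrable _ _)]
  simp only [arctan_one, arctan_zero]
  field_simp
  ring

lemma integral_unitTDensity_le_three {n : ℕ} (hn : 4 ≤ n) :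
    ∫ x in (0 : ℝ)..1, unitTDensity n x ≤ ∫ x in (0 : ℝ)..1, unitTDensity 3 x := by
  have hlow : (0.40915 : ℝ) ≤ ∫ x in (0 : ℝ)..1, unitTDensity 3 x := by
    rw [integral_unitTDensity_three]
    have : 1 / (2 * 3.1416) ≤ 1 / (2 * π) := by
      have := pi_lt_d4
      gcongr
    norm_num at this ⊢
    linarith
  refine le_trans ?_ hlow
  obtain rfl | rfl | hn6 : n = 4 ∨ n = 5 ∨ 6 ≤ n := by omega
  · have h := integral_unitTDensity_le (v := 4) (p := 1) (q := 0.48) (by norm_num)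
      (fun s hs => by norm_num; nlinarith [mul_nonneg hs (sq_nonneg (s - 0.64)), mul_nonneg hs hs])
    have hc : unitTConst 4 ≤ 0.5304 :=
      (sq_le_sq₀ (unitTConst_pos (by norm_num)).le (by norm_num)).1
        (by rw [unitTConst_four_sq]; norm_num)
    norm_num at h hc ⊢
    linarith
  · have h := integral_unitTDensity_le (v := 5) (p := 0.8) (q := 0.32) (by norm_num)
      (fun s hs => by norm_num; nlinarith [mul_nonneg hs (sq_nonneg (s - 0.75)), mul_nonneg hs hs])
    have hc : unitTConst 5 ≤ 0.5 := by
      refine (sq_le_sq₀ (unitTConst_pos (by norm_num)).le (by norm_num)).1 ?_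
      rw [unitTConst_five_sq]
      have hp := pi_gt_d2
      have : 64 / (27 * π ^ 2) ≤ 64 / (27 * 3.14 ^ 2) := by gcongr
      norm_num at this ⊢
      linarith
    norm_num at h hc ⊢
    linarith
  · obtain ⟨m, rfl⟩ := Nat.exists_eq_add_of_le' hn6
    have hm : (0 : ℝ) ≤ m := Nat.cast_nonneg m
    push_cast
    have hv : (2 : ℝ) < m + 6 := by linarith
    have hk : (1 / 2 : ℝ) ≤ (m + 6 + 1) / (2 * (m + 6 - 2)) := by
      rw [div_le_div_iff₀ (by norm_num) (by linarith)]
      linarith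
    have h := integral_unitTDensity_le (v := m + 6) (p := 0.48) (q := 0.16) hv
      (fun s hs => by
        have hq : (0 : ℝ) ≤ 1 - 0.48 * s + 0.16 * s ^ 2 := by nlinarith [sq_nonneg (s - 1.5)]
        have h1 : 1 + 1 / 2 * s ≤ 1 + (m + 6 + 1) / (2 * (m + 6 - 2)) * s := by gcongr
        refine le_trans ?_ (mul_le_mul_of_nonneg_right h1 hq)
        nlinarith [mul_nonneg hs (sq_nonneg (s - 0.5))])
    have hc : unitTConst (m + 6) ≤ 15 / 32 :=
      (sq_le_sq₀ (unitTConst_pos hv).le (by norm_num)).1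
        ((unitTConst_sq_le m).trans (by norm_num))
    norm_num at h hc ⊢
    linarith

lemma antitoneOn_log_unitT_sub {v : ℝ} (hv : 3 ≤ v) :
    AntitoneOn (fun s => (v + 1) / 2 * log (1 + s / (v - 2)) - 2 * log (1 + s))
      (Set.Icc (0 : ℝ) 1) := by
  have hw : 0 < v - 2 := by linarith
  have hd : ∀ s : ℝ, 0 ≤ s →
      HasDerivAt (fun s => (v + 1) / 2 * log (1 + s / (v - 2)) - 2 * log (1 + s))
        ((v + 1) / 2 * ((1 / (v - 2)) / (1 + s / (v - 2))) - 2 * (1 / (1 + s))) s := by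
    intro s hs
    have h1 : HasDerivAt (fun s : ℝ => 1 + s / (v - 2)) (1 / (v - 2)) s :=
      ((hasDerivAt_id s).div_const _).const_add 1
    have h2 : HasDerivAt (fun s : ℝ => 1 + s) 1 s := (hasDerivAt_id s).const_add 1
    exact ((h1.log (by positivity)).const_mul _).sub ((h2.log (by positivity)).const_mul _)
  refine antitoneOn_of_deriv_nonpos (convex_Icc 0 1)
    (fun s hs => (hd s hs.1).continuousAt.continuousWithinAt)
    (fun s hs => (hd s (interior_subset hs).1).differentiableAt.differentiableWithinAt) ?_
  intro s hs
  have hs' := interior_subset hs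
  have h0 : 0 ≤ s := hs'.1
  have h1 : s ≤ 1 := hs'.2
  rw [(hd s h0).deriv]
  have e : (v + 1) / 2 * ((1 / (v - 2)) / (1 + s / (v - 2))) - 2 * (1 / (1 + s))
      = (v - 3) * (s - 3) / (2 * (v - 2 + s) * (1 + s)) := by
    have : v - 2 + s ≠ 0 := by positivity
    field_simp
    ring
  rw [e]
  exact div_nonpos_of_nonpos_of_nonneg
    (mul_nonpos_of_nonneg_of_nonpos (by linarith) (by linarith)) (by positivity)

lemma unitTDensity_pos {v : ℝ} (hv : 2 < v) (x : ℝ) : 0 < unitTDensity v x := by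
  have hw : 0 < v - 2 := by linarith
  exact mul_pos (unitTConst_pos hv) (rpow_pos_of_pos (by positivity) _)

lemma log_unitTDensity {v : ℝ} (hv : 2 < v) (x : ℝ) :
    log (unitTDensity v x)
      = log (unitTConst v) - (v + 1) / 2 * log (1 + x ^ 2 / (v - 2)) := by
  have hw : 0 < v - 2 := by linarith
  rw [unitTDensity, log_mul (unitTConst_pos hv).ne' (rpow_pos_of_pos (by positivity) _).ne',
    log_rpow (by positivity)]
  ring

lemma log_unitTDensity_sub_le {v x z : ℝ} (hv : 3 ≤ v) (hx : 0 ≤ x) (hxz : x ≤ z) (hz : z ≤ 1) :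
    log (unitTDensity 3 z) - log (unitTDensity v z)
      ≤ log (unitTDensity 3 x) - log (unitTDensity v x) := by
  have hz0 : 0 ≤ z := hx.trans hxz
  have h := antitoneOn_log_unitT_sub hv (a := x ^ 2) (b := z ^ 2)
    ⟨by positivity, by nlinarith⟩ ⟨by positivity, by nlinarith⟩ (by gcongr)
  simp only [log_unitTDensity (show (2 : ℝ) < 3 by norm_num),
    log_unitTDensity (show 2 < v by linarith), show (3 : ℝ) - 2 = 1 by norm_num, div_one]
  norm_num
  linarith

lemma integral_unitTDensity_le_three_of_le_one {n : ℕ} (hn : 4 ≤ n) {y : ℝ} (hy0 : 0 ≤ y)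
    (hy1 : y ≤ 1) :
    ∫ x in (0 : ℝ)..y, unitTDensity n x ≤ ∫ x in (0 : ℝ)..y, unitTDensity 3 x := by
  have hv : (4 : ℝ) ≤ n := by exact_mod_cast hn
  have hp : ∀ x, 0 < unitTDensity n x := unitTDensity_pos (by linarith)
  have hp3 : ∀ x, 0 < unitTDensity 3 x := unitTDensity_pos (by norm_num)
  have hi : ∀ a b, IntervalIntegrable (unitTDensity n) volume a b := fun a b =>
    (continuous_unitTDensity (by linarith)).intervalIntegrable a b
  have hi3 : ∀ a b, IntervalIntegrable (unitTDensity 3) volume a b := fun a b =>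
    (continuous_unitTDensity (by norm_num)).intervalIntegrable a b
  rcases le_total (unitTDensity n y) (unitTDensity 3 y) with h | h
  · refine intervalIntegral.integral_mono_on hy0 (hi _ _) (hi3 _ _) fun x hx => ?_
    have h1 := log_le_log (hp y) h
    have h2 := log_unitTDensity_sub_le (v := n) (by linarith) hx.1 hx.2 hy1
    exact (log_le_log_iff (hp x) (hp3 x)).1 (by linarith)
  · have hmono : ∫ x in y..1, unitTDensity 3 x ≤ ∫ x in y..1, unitTDensity n x := by
      refine intervalIntegral.integral_mono_on hy1 (hi3 _ _) (hi _ _) fun x hx => ?_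
      have h1 := log_le_log (hp3 y) h
      have h2 := log_unitTDensity_sub_le (v := n) (by linarith) hy0 hx.1 hx.2
      exact (log_le_log_iff (hp3 x) (hp x)).1 (by linarith)
    have e := intervalIntegral.integral_add_adjacent_intervals (hi 0 y) (hi y 1)
    have e3 := intervalIntegral.integral_add_adjacent_intervals (hi3 0 y) (hi3 y 1)
    have hone := integral_unitTDensity_le_three hn
    linarith

lemma tCDF_mul_sqrt_le_three {n : ℕ} (hn : 3 ≤ n) {y : ℝ} (hy0 : 0 ≤ y) (hy1 : y ≤ 1) :
    tCDF n (y * √((n : ℝ) / ((n : ℝ) - 2))) ≤ tCDF 3 (y * √3) := by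
  have hv : (3 : ℝ) ≤ n := by exact_mod_cast hn
  have h3 := tCDF_mul_sqrt (v := 3) (by norm_num) y
  rw [show (3 : ℝ) / (3 - 2) = 3 by norm_num] at h3
  rw [h3, tCDF_mul_sqrt (by linarith)]
  obtain rfl | hn4 := hn.eq_or_lt
  · exact le_of_eq (by norm_num)
  · have := integral_unitTDensity_le_three_of_le_one hn4 hy0 hy1
    linarith

theorem stmt_17 (y : ℝ) (hy0 : 0 < y) (hy1 : y ≤ 1) :
    sInf {p : ℝ | ∃ v : ℕ, 3 ≤ v ∧
        p = 2 - 2 * tCDF v (y * Real.sqrt ((v : ℝ) / ((v : ℝ) - 2)))}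
      = min (2 - 2 * tCDF 3 (y * Real.sqrt 3)) (2 - 2 * tCDF 4 (y * Real.sqrt 2)) := by
  have h4 := tCDF_mul_sqrt_le_three (n := 4) (by norm_num) hy0.le hy1
  rw [show ((4 : ℕ) : ℝ) / (((4 : ℕ) : ℝ) - 2) = 2 by norm_num, Nat.cast_ofNat] at h4
  rw [min_eq_left (by linarith)]
  refine IsLeast.csInf_eq ⟨⟨3, le_rfl, ?_⟩, ?_⟩
  · rw [show ((3 : ℕ) : ℝ) / (((3 : ℕ) : ℝ) - 2) = 3 by norm_num, Nat.cast_ofNat]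
  · rintro p ⟨v, hv, rfl⟩
    have := tCDF_mul_sqrt_le_three hv hy0.le hy1
    linarith
end

section
/- Let y be a real number with y > √3 and define v₀(y) := max{V₃, 2C₃/|y²−3| + 1} with the constants C₁, C₂, C₃, V₁, V₂, V₃ as specified. Then the infimum over integers v ≥ 3 of J_v(y) = 2·F_v(y·√(v/(v−2))) − 1 equals the minimum of J_v(y) over the finitely many integers v with 3 ≤ v ≤ ⌊v₀(y)⌋ + 3. -/
open MeasureTheory Real

open Set Filter Topology

/-- The normalising constant of the Student t density in the variable `x / √v`. -/
noncomputable def tScaledConst (v : ℝ) : ℝ :=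
  Real.Gamma ((v + 1) / 2) / (Real.sqrt π * Real.Gamma (v / 2))

lemma tScaledConst_pos {v : ℝ} (hv : 0 < v) : 0 < tScaledConst v := by
  have h₁ := Real.Gamma_pos_of_pos (show 0 < (v + 1) / 2 by positivity)
  have h₂ := Real.Gamma_pos_of_pos (show 0 < v / 2 by positivity)
  unfold tScaledConst
  positivity

lemma tScaledConst_add_two {v : ℝ} (hv : 0 < v) :
    tScaledConst (v + 2) = tScaledConst v * ((v + 1) / v) := by
  have h₁ : Real.Gamma ((v + 2 + 1) / 2) = (v + 1) / 2 * Real.Gamma ((v + 1) / 2) := by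
    rw [← Real.Gamma_add_one (by positivity)]
    congr 1
    ring
  have h₂ : Real.Gamma ((v + 2) / 2) = v / 2 * Real.Gamma (v / 2) := by
    rw [← Real.Gamma_add_one (by positivity)]
    congr 1
    ring
  have h₃ := Real.Gamma_pos_of_pos (show 0 < v / 2 by positivity)
  have h₄ : 0 < Real.sqrt π := Real.sqrt_pos.2 Real.pi_pos
  unfold tScaledConst
  rw [h₁, h₂]
  field_simp

lemma integral_Iic_comp_div (g : ℝ → ℝ) (t : ℝ) {s : ℝ} (hs : 0 < s) :
    ∫ x in Iic t, g (x / s) = s * ∫ x in Iic (t / s), g x := by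
  have key (c : ℝ) (f : ℝ → ℝ) : ∫ x in Iic c, f x = ∫ x in Ioi (-c), f (-x) := by
    rw [← integral_comp_neg_Iic]
    simp
  have h := integral_comp_mul_left_Ioi (fun x => g (-x)) (-t) (inv_pos.2 hs)
  rw [key t, key (t / s)]
  simp only [inv_inv, smul_eq_mul] at h
  rw [show -(t / s) = s⁻¹ * -t by field_simp, ← h]
  refine integral_congr_ae (Eventually.of_forall fun x => ?_)
  simp only
  congr 1
  field_simp

lemma tCDF_eq_scaled {v : ℝ} (hv : 0 < v) (t : ℝ) :
    tCDF v t = tScaledConst v * ∫ x in Iic (t / Real.sqrt v), (1 + x ^ 2) ^ (-((v + 1) / 2)) := by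
  have hs : 0 < Real.sqrt v := Real.sqrt_pos.2 hv
  have h (x : ℝ) : tDensity v x = tScaledConst v / Real.sqrt v *
      (1 + (x / Real.sqrt v) ^ 2) ^ (-((v + 1) / 2)) := by
    have h₃ := Real.Gamma_pos_of_pos (show 0 < v / 2 by positivity)
    have h₄ : 0 < Real.sqrt π := Real.sqrt_pos.2 Real.pi_pos
    unfold tDensity tScaledConst
    rw [div_pow, Real.sq_sqrt hv.le, Real.sqrt_mul hv.le]
    field_simp
  unfold tCDF
  simp_rw [h]
  rw [integral_const_mul,
    integral_Iic_comp_div (fun x => (1 + x ^ 2) ^ (-((v + 1) / 2))) t hs]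
  field_simp

lemma integrable_one_add_sq_rpow {q : ℝ} (hq : 1 / 2 < q) :
    Integrable fun x : ℝ => (1 + x ^ 2) ^ (-q) := by
  have h := integrable_rpow_neg_one_add_norm_sq (E := ℝ) (μ := volume) (r := 2 * q)
    (by simp; linarith)
  simp only [Real.norm_eq_abs, sq_abs] at h
  rwa [show -(2 * q) / 2 = -q by ring] at h

lemma tendsto_mul_one_add_sq_rpow_atBot {q : ℝ} (hq : 1 / 2 < q) :
    Tendsto (fun x : ℝ => x * (1 + x ^ 2) ^ (-q)) atBot (𝓝 0) := by
  have h₁ : Tendsto (fun x : ℝ => 1 + x ^ 2) atBot atTop :=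
    tendsto_atTop_add_const_left _ _ ((tendsto_pow_atTop two_ne_zero).comp tendsto_abs_atBot_atTop
      |>.congr fun x => by simp)
  have h₂ := (tendsto_rpow_neg_atTop (show 0 < q - 1 / 2 by linarith)).comp h₁
  refine squeeze_zero_norm (fun x => ?_) h₂
  have hx : 0 < 1 + x ^ 2 := by positivity
  have hle : |x| ≤ (1 + x ^ 2) ^ (1 / 2 : ℝ) := by
    rw [← Real.sqrt_eq_rpow]
    exact Real.abs_le_sqrt (by linarith)
  rw [Real.norm_eq_abs, abs_mul, abs_of_pos (Real.rpow_pos_of_pos hx _), Function.comp_apply,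
    show -(q - 1 / 2) = 1 / 2 + -q by ring, Real.rpow_add hx]
  gcongr

lemma hasDerivAt_mul_one_add_sq_rpow (q x : ℝ) :
    HasDerivAt (fun x : ℝ => x * (1 + x ^ 2) ^ (-q))
      (2 * q * (1 + x ^ 2) ^ (-(q + 1)) - (2 * q - 1) * (1 + x ^ 2) ^ (-q)) x := by
  have hx : 0 < 1 + x ^ 2 := by positivity
  have h₁ : HasDerivAt (fun x : ℝ => 1 + x ^ 2) (2 * x) x := by
    simpa using (hasDerivAt_pow 2 x).const_add 1
  refine ((hasDerivAt_id x).mul (h₁.rpow_const (p := -q) (Or.inl hx.ne'))).congr_deriv ?_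
  have h₂ : (1 + x ^ 2) ^ (-q) = (1 + x ^ 2) ^ (-(q + 1)) * (1 + x ^ 2) := by
    rw [← Real.rpow_add_one hx.ne']
    congr 1
    ring
  rw [show -q - 1 = -(q + 1) by ring, h₂]
  simp only [id]
  ring

lemma tScaled_integral_recurrence {v : ℝ} (hv : 0 < v) (a : ℝ) :
    tScaledConst (v + 2) * ∫ x in Iic a, (1 + x ^ 2) ^ (-((v + 2 + 1) / 2)) =
      tScaledConst v * (∫ x in Iic a, (1 + x ^ 2) ^ (-((v + 1) / 2))) +
        tScaledConst v / v * (a * (1 + a ^ 2) ^ (-((v + 1) / 2))) := by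
  set q := (v + 1) / 2 with hq
  have hq' : 1 / 2 < q := by rw [hq]; linarith
  have i₁ := (integrable_one_add_sq_rpow hq').integrableOn (s := Iic a)
  have i₂ := (integrable_one_add_sq_rpow (show 1 / 2 < q + 1 by linarith)).integrableOn
    (s := Iic a)
  have h := integral_Iic_of_hasDerivAt_of_tendsto'
    (fun x (_ : x ∈ Iic a) => hasDerivAt_mul_one_add_sq_rpow q x)
    ((i₂.const_mul (2 * q)).sub (i₁.const_mul (2 * q - 1)))
    (tendsto_mul_one_add_sq_rpow_atBot hq')
  rw [integral_sub (i₂.const_mul (2 * q)) (i₁.const_mul (2 * q - 1)), integral_const_mul,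
    integral_const_mul] at h
  rw [show (v + 2 + 1) / 2 = q + 1 by rw [hq]; ring, tScaledConst_add_two hv]
  rw [sub_zero] at h
  rw [← h, show 2 * q = v + 1 by rw [hq]; ring]
  field_simp
  ring

lemma one_add_sq_rpow_le {p b t : ℝ} (hp : 0 ≤ p) (ht : 0 ≤ t) (htb : t ≤ b)
    (hW : 2 * p * b * (b - t) ≤ 1) :
    (1 + t ^ 2) ^ (-p) ≤
      (1 + b ^ 2) ^ (-p) * (1 + 2 * p * b * (b - t) + (2 * p * b * (b - t)) ^ 2) := by
  have h₁ : 0 < 1 + t ^ 2 := by positivity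
  have h₂ : 0 < 1 + b ^ 2 := by positivity
  have h₀ : 0 ≤ 2 * p * b * (b - t) :=
    mul_nonneg (mul_nonneg (by positivity) (ht.trans htb)) (by linarith)
  have hratio : 1 + b ^ 2 ≤ (1 + t ^ 2) * Real.exp (2 * b * (b - t)) := by
    have he := Real.add_one_le_exp (2 * b * (b - t))
    have : 0 ≤ t ^ 2 * (2 * b * (b - t)) :=
      mul_nonneg (sq_nonneg _) (mul_nonneg (by linarith) (by linarith))
    nlinarith [mul_le_mul_of_nonneg_left he h₁.le, sq_nonneg (b - t)]
  have hpow := Real.rpow_le_rpow h₂.le hratio hp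
  rw [Real.mul_rpow h₁.le (Real.exp_pos _).le, ← Real.exp_mul] at hpow
  have hexp : Real.exp (2 * b * (b - t) * p) ≤
      1 + 2 * p * b * (b - t) + (2 * p * b * (b - t)) ^ 2 := by
    have := (abs_le.1 (Real.abs_exp_sub_one_sub_id_le (x := 2 * p * b * (b - t))
      (by rwa [abs_of_nonneg h₀]))).2
    rw [show 2 * b * (b - t) * p = 2 * p * b * (b - t) by ring]
    linarith
  rw [Real.rpow_neg h₁.le, Real.rpow_neg h₂.le, inv_mul_eq_div,
    le_div_iff₀ (Real.rpow_pos_of_pos h₂ _), inv_mul_le_iff₀ (Real.rpow_pos_of_pos h₁ _)]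
  exact hpow.trans (mul_le_mul_of_nonneg_left hexp (Real.rpow_pos_of_pos h₁ _).le)

lemma integral_one_add_sq_rpow_le {p b c : ℝ} (hp : 0 ≤ p) (hc : 0 ≤ c) (hcb : c ≤ b)
    (hW : 2 * p * b * (b - c) ≤ 1) :
    ∫ t in c..b, (1 + t ^ 2) ^ (-p) ≤
      (1 + b ^ 2) ^ (-p) * ((b - c) * (1 + 2 * p * b * (b - c) / 2 +
        (2 * p * b * (b - c)) ^ 2)) := by
  set M := (1 + b ^ 2) ^ (-p) with hM
  set W := 2 * p * b * (b - c) with hWdef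
  have hM0 : 0 ≤ M := by positivity
  have hpb : 0 ≤ 2 * p * b := mul_nonneg (by positivity) (hc.trans hcb)
  have hcont : Continuous fun t : ℝ => (1 + t ^ 2) ^ (-p) :=
    Continuous.rpow_const (by fun_prop) fun t => Or.inl (by positivity)
  have hcont' : Continuous fun t : ℝ => M * ((1 + W ^ 2) + 2 * p * b * (b - t)) := by fun_prop
  have hle : ∫ t in c..b, (1 + t ^ 2) ^ (-p) ≤
      ∫ t in c..b, M * ((1 + W ^ 2) + 2 * p * b * (b - t)) := by
    refine intervalIntegral.integral_mono_on hcb (hcont.intervalIntegrable _ _)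
      (hcont'.intervalIntegrable _ _) fun t ht => ?_
    have hle₁ : 2 * p * b * (b - t) ≤ W :=
      mul_le_mul_of_nonneg_left (by linarith [ht.1]) hpb
    have h₀ : 0 ≤ 2 * p * b * (b - t) := mul_nonneg hpb (by linarith [ht.2])
    refine (one_add_sq_rpow_le hp (hc.trans ht.1) ht.2 (hle₁.trans hW)).trans ?_
    refine mul_le_mul_of_nonneg_left ?_ hM0
    have := pow_le_pow_left₀ h₀ hle₁ 2
    linarith
  refine hle.trans (le_of_eq ?_)
  have hprim (t : ℝ) : HasDerivAt
      (fun t : ℝ => M * ((1 + W ^ 2) * t - p * b * (b - t) ^ 2))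
      (M * ((1 + W ^ 2) + 2 * p * b * (b - t))) t := by
    have h₁ : HasDerivAt (fun t : ℝ => b - t) (-1) t := by
      simpa using (hasDerivAt_id t).const_sub b
    refine ((((hasDerivAt_id t).const_mul (1 + W ^ 2)).sub
      ((h₁.pow 2).const_mul (p * b))).const_mul M).congr_deriv ?_
    push_cast
    ring
  rw [intervalIntegral.integral_eq_sub_of_hasDerivAt (fun t _ => hprim t)
    (hcont'.intervalIntegrable _ _)]
  simp only [hWdef]
  ring

lemma one_sub_sqrt_le {v : ℝ} (hv : 100 ≤ v) :
    v * (1 - Real.sqrt ((v - 2) / v)) ≤ 1 + 1 / (2 * v) + 1 / v ^ 2 := by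
  have hv0 : 0 < v := by linarith
  set e := 1 / v with he
  have he0 : 0 < e := by positivity
  have hve : v * e = 1 := by rw [he]; field_simp
  have he1 : e ≤ 1 / 100 := by rw [he]; gcongr
  have hsqrt : 1 - e - e ^ 2 / 2 - e ^ 3 ≤ Real.sqrt ((v - 2) / v) := by
    apply Real.le_sqrt_of_sq_le
    rw [show (v - 2) / v = 1 - 2 * e by rw [he]; field_simp]
    nlinarith [pow_pos he0 3, pow_pos he0 4, pow_pos he0 5, pow_pos he0 2,
      mul_le_mul_of_nonneg_left he1 (pow_pos he0 3).le,
      mul_le_mul_of_nonneg_left he1 (pow_pos he0 4).le,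
      mul_le_mul_of_nonneg_left he1 (pow_pos he0 5).le]
  rw [show 1 / (2 * v) = e / 2 by rw [he]; field_simp,
    show 1 / v ^ 2 = e ^ 2 by rw [he]; field_simp]
  calc v * (1 - Real.sqrt ((v - 2) / v)) ≤ v * (e + e ^ 2 / 2 + e ^ 3) :=
        mul_le_mul_of_nonneg_left (by linarith) hv0.le
    _ = (v * e) * (1 + e / 2 + e ^ 2) := by ring
    _ = 1 + e / 2 + e ^ 2 := by rw [hve, one_mul]

lemma trapezoid_polynomial_bound {x e : ℝ} (he0 : 0 < e) (he1 : e ≤ 1 / 100) (hx8 : x ≤ 1 / 8)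
    (hxe : 3 * e ≤ x) (hg : 4 * x ^ 2 + 10 * (x * e) + 2 * e ^ 2 ≤ x - 3 * e) :
    (1 + e) * (1 + e / 2 + e ^ 2) * (1 + (x / 2 + 3 * x * e + 2 * x ^ 2)) ≤ 1 + x := by
  have hx0 : 0 < x := by linarith
  have hxe2 : 3 * e ^ 2 ≤ x * e := by
    linarith [mul_le_mul_of_nonneg_right hxe he0.le]
  have he2 : (1 + e) * (1 + e / 2 + e ^ 2) ≤ 1 + 3 / 2 * e + 8 / 5 * e ^ 2 := by
    linarith [mul_le_mul_of_nonneg_left he1 (sq_nonneg e), sq_nonneg e]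
  have hX8 : x / 2 + 3 * x * e + 2 * x ^ 2 ≤ 4 / 5 * x := by
    linarith [mul_le_mul_of_nonneg_left he1 hx0.le, mul_le_mul_of_nonneg_left hx8 hx0.le]
  have he3 : 3 / 2 * e + 8 / 5 * e ^ 2 ≤ 8 / 5 * e := by
    linarith [mul_le_mul_of_nonneg_left he1 he0.le]
  have hprod := mul_le_mul he3 hX8 (by positivity) (by positivity)
  have hexp := mul_le_mul_of_nonneg_right he2
    (show 0 ≤ 1 + (x / 2 + 3 * x * e + 2 * x ^ 2) by positivity)
  linarith [sq_nonneg e]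

lemma trapezoid_bound {v s d : ℝ} (hv : 100 ≤ v) (hs : 3 < s) (hsv : 8 * s ≤ v)
    (hgap : 4 * s ^ 2 + 10 * s + 2 ≤ v * (s - 3)) (hd : 0 ≤ d)
    (hdv : v * d ≤ 1 + 1 / (2 * v) + 1 / v ^ 2) :
    (v + 3) * (s / (v - 2)) * d ≤ 1 ∧
      d * (1 + (v + 3) * (s / (v - 2)) * d / 2 + ((v + 3) * (s / (v - 2)) * d) ^ 2) ≤
        (1 + s / (v - 2)) / (v + 1) := by
  have hv0 : 0 < v := by linarith
  have hv2 : 0 < v - 2 := by linarith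
  set e := 1 / v with he
  have he0 : 0 < e := by positivity
  have hve : v * e = 1 := by rw [he]; field_simp
  have he1 : e ≤ 1 / 100 := by rw [he]; gcongr
  rw [show 1 / (2 * v) = e / 2 by rw [he]; field_simp,
    show 1 / v ^ 2 = e ^ 2 by rw [he]; field_simp] at hdv
  set W := (v + 3) * (s / (v - 2)) * d with hW
  have hW0 : 0 ≤ W := by positivity
  set x := s * e with hx
  have hx0 : 0 < x := by positivity
  have hx8 : x ≤ 1 / 8 := by
    have := mul_le_mul_of_nonneg_right hsv he0.le
    rw [hve] at this
    rw [hx]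
    linarith
  have hWle : W ≤ x * (1 + 6 * e) := by
    have hfac : (v + 3) / (v - 2) * (v * d) ≤ 1 + 6 * e := by
      have h₁ : (v + 3) / (v - 2) ≤ 1 + 26 / 5 * e := by
        rw [div_le_iff₀ hv2]
        nlinarith
      calc (v + 3) / (v - 2) * (v * d) ≤ (1 + 26 / 5 * e) * (1 + e / 2 + e ^ 2) := by
            gcongr
        _ ≤ 1 + 6 * e := by
          nlinarith [pow_pos he0 2, mul_le_mul_of_nonneg_left he1 (pow_pos he0 2).le]
    calc W = x * ((v + 3) / (v - 2) * (v * d)) := by rw [hW, hx, he]; field_simp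
      _ ≤ _ := mul_le_mul_of_nonneg_left hfac hx0.le
  have hW1 : W ≤ 1 := by nlinarith
  refine ⟨hW1, ?_⟩
  have hWx : W ^ 2 ≤ 2 * x ^ 2 := by
    have : W ≤ x * (11 / 10) := hWle.trans (by gcongr; linarith)
    nlinarith
  rw [le_div_iff₀ (by linarith)]
  have hgap' : (4 * s ^ 2 + 10 * s + 2) * e ^ 2 ≤ (s - 3) * e := by
    have := mul_le_mul_of_nonneg_right hgap (sq_nonneg e)
    calc _ ≤ v * (s - 3) * e ^ 2 := this
      _ = (v * e) * ((s - 3) * e) := by ring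
      _ = _ := by rw [hve, one_mul]
  have hX : W / 2 + W ^ 2 ≤ x / 2 + 3 * x * e + 2 * x ^ 2 := by linarith
  have hfin : (1 + e) * (1 + e / 2 + e ^ 2) * (1 + (x / 2 + 3 * x * e + 2 * x ^ 2)) ≤ 1 + x := by
    have hg : 4 * x ^ 2 + 10 * (x * e) + 2 * e ^ 2 ≤ x - 3 * e := by
      rw [hx]
      linarith
    exact trapezoid_polynomial_bound he0 he1 hx8
      (mul_le_mul_of_nonneg_right hs.le he0.le) hg
  calc d * (1 + W / 2 + W ^ 2) * (v + 1)
      = (1 + e) * (v * d) * (1 + (W / 2 + W ^ 2)) * 1 := by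
        rw [he]; field_simp; ring
    _ ≤ (1 + e) * (1 + e / 2 + e ^ 2) * (1 + (x / 2 + 3 * x * e + 2 * x ^ 2)) * 1 := by gcongr
    _ ≤ 1 + x := by rw [mul_one]; exact hfin
    _ ≤ 1 + s / (v - 2) := by
        rw [hx, he, mul_one_div]
        gcongr
        linarith

lemma J_le_J_add_two {v y : ℝ} (hy : 0 < y) (hv : 100 ≤ v) (hs : 3 < y ^ 2)
    (hsv : 8 * y ^ 2 ≤ v) (hgap : 4 * (y ^ 2) ^ 2 + 10 * y ^ 2 + 2 ≤ v * (y ^ 2 - 3)) :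
    J v y ≤ J (v + 2) y := by
  have hv0 : 0 < v := by linarith
  have hv2 : 0 < v - 2 := by linarith
  have hsv0 : 0 < Real.sqrt v := Real.sqrt_pos.2 hv0
  have hsv2 : 0 < Real.sqrt (v - 2) := Real.sqrt_pos.2 hv2
  set b := y / Real.sqrt (v - 2) with hb
  set c := y / Real.sqrt v with hc
  have hb0 : 0 < b := by positivity
  have hc0 : 0 < c := by positivity
  have hb2 : b ^ 2 = y ^ 2 / (v - 2) := by rw [hb, div_pow, Real.sq_sqrt hv2.le]
  have hcb : c ≤ b := by
    rw [hb, hc]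
    gcongr
    linarith
  set d := 1 - Real.sqrt ((v - 2) / v) with hd
  have hbc : b - c = b * d := by
    rw [hd, hb, hc, Real.sqrt_div hv2.le]
    field_simp
  have hd0 : 0 ≤ d := by
    by_contra h
    nlinarith
  obtain ⟨hW, hmain⟩ := trapezoid_bound hv hs hsv hgap hd0 (one_sub_sqrt_le hv)
  have hWeq : 2 * ((v + 2 + 1) / 2) * b * (b - c) = (v + 3) * (y ^ 2 / (v - 2)) * d := by
    rw [hbc, ← hb2]
    ring
  have hint := integral_one_add_sq_rpow_le (p := (v + 2 + 1) / 2) (by positivity) hc0.le hcb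
    (hWeq.trans_le hW)
  rw [hWeq, hbc] at hint
  rw [← hb2] at hint hmain
  have hpow : (1 + b ^ 2) ^ (-((v + 1) / 2)) =
      (1 + b ^ 2) ^ (-((v + 2 + 1) / 2)) * (1 + b ^ 2) := by
    rw [← Real.rpow_add_one (by positivity)]
    congr 1
    ring
  have hbound : ∫ t in c..b, (1 + t ^ 2) ^ (-((v + 2 + 1) / 2)) ≤
      b * (1 + b ^ 2) ^ (-((v + 1) / 2)) / (v + 1) := by
    rw [hpow]
    refine hint.trans ?_
    have := mul_le_mul_of_nonneg_left hmain
      (show 0 ≤ (1 + b ^ 2) ^ (-((v + 2 + 1) / 2)) * b by positivity)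
    calc _ = _ := by ring
      _ ≤ _ := this
      _ = _ := by ring
  have i₂ := integrable_one_add_sq_rpow (show 1 / 2 < (v + 2 + 1) / 2 by linarith)
  have hsplit := intervalIntegral.integral_Iic_sub_Iic
    (i₂.integrableOn (s := Iic c)) (i₂.integrableOn (s := Iic b))
  have hrec := tScaled_integral_recurrence hv0 b
  have e₁ : y * Real.sqrt (v / (v - 2)) / Real.sqrt v = b := by
    rw [hb, Real.sqrt_div hv0.le]
    field_simp
  have e₂ : y * Real.sqrt ((v + 2) / (v + 2 - 2)) / Real.sqrt (v + 2) = c := by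
    have : 0 < Real.sqrt (v + 2) := Real.sqrt_pos.2 (by linarith)
    rw [hc, Real.sqrt_div (by linarith), add_sub_cancel_right]
    field_simp
  have hK := tScaledConst_pos hv0
  have hK2 := tScaledConst_pos (show 0 < v + 2 by linarith)
  unfold J
  rw [tCDF_eq_scaled hv0, tCDF_eq_scaled (show 0 < v + 2 by linarith), e₁, e₂]
  have hfinal := mul_le_mul_of_nonneg_left hbound hK2.le
  have hcoef : tScaledConst (v + 2) * (b * (1 + b ^ 2) ^ (-((v + 1) / 2)) / (v + 1)) =
      tScaledConst v / v * (b * (1 + b ^ 2) ^ (-((v + 1) / 2))) := by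
    rw [tScaledConst_add_two hv0]
    field_simp
  rw [hcoef, ← hsplit, mul_sub] at hfinal
  linarith

/-- The infimum of a sequence from index `3` on is attained early if the sequence increases in
steps of two beyond that. -/
lemma sInf_eq_of_le_add_two (f : ℕ → ℝ) (N : ℕ) (hN : 4 ≤ N)
    (hf : ∀ n, N ≤ n + 1 → f n ≤ f (n + 2)) :
    sInf {p : ℝ | ∃ v : ℕ, 3 ≤ v ∧ p = f v} =
      sInf {p : ℝ | ∃ v : ℕ, 3 ≤ v ∧ v ≤ N ∧ p = f v} := by
  set S := {p : ℝ | ∃ v : ℕ, 3 ≤ v ∧ p = f v}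
  set T := {p : ℝ | ∃ v : ℕ, 3 ≤ v ∧ v ≤ N ∧ p = f v}
  have hTS : T ⊆ S := fun p ⟨v, h₁, _, h₃⟩ => ⟨v, h₁, h₃⟩
  have hT : T.Nonempty := ⟨f 3, 3, le_rfl, by lia, rfl⟩
  have hTb : BddBelow T := by
    refine (((Finset.range (N + 1)).image f).finite_toSet.subset ?_).bddBelow
    rintro p ⟨v, _, hv, rfl⟩
    simp only [Finset.coe_image, Finset.coe_range]
    exact ⟨v, by simpa [Nat.lt_succ_iff] using hv, rfl⟩
  have hle (v : ℕ) (hv : 3 ≤ v) : sInf T ≤ f v := by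
    induction v using Nat.strong_induction_on with
    | _ v ih =>
      by_cases h : v ≤ N
      · exact csInf_le hTb ⟨v, hv, h, rfl⟩
      · obtain ⟨n, rfl⟩ := Nat.exists_eq_add_of_le' (show 2 ≤ v by lia)
        exact (ih n (by lia) (by lia)).trans (hf n (by lia))
  have hSlb : sInf T ∈ lowerBounds S := by
    rintro p ⟨v, hv, rfl⟩
    exact hle v hv
  exact le_antisymm (csInf_le_csInf ⟨_, hSlb⟩ hT hTS) (le_csInf (hT.mono hTS) hSlb)

theorem stmt_18 (y C₁ C₂ C₃ V₁ V₂ V₃ v₀ : ℝ)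
    (hy : Real.sqrt 3 < y)
    (hC₁ : C₁ = 2 * y ^ 6 + (3 / 4) * y ^ 4)
    (hC₂ : C₂ = (9 / 4) * C₁ + (25 / 32) * y ^ 8
        + (3 / 2) * (C₁ ^ ((2 : ℝ) / 3) * y ^ ((8 : ℝ) / 3)
          + C₁ ^ ((1 : ℝ) / 3) * y ^ ((16 : ℝ) / 3)))
    (hC₃ : C₃ = (13 / 3) * y ^ 4 + 18 * y ^ 2 + 2 * C₂ + 11)
    (hV₁ : V₁ = max 100 (8 * y ^ 2))
    (hV₂ : V₂ = max V₁ (max ((3 / 2) * y ^ 4) (Real.sqrt (2 * C₁))))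
    (hV₃ : V₃ = max V₂ (max (2 + 2 * y ^ 2 / (1 + 2 * y))
        (2 + 2 * y ^ 4 / (1 + 2 * y ^ 2))))
    (hv₀ : v₀ = max V₃ (2 * C₃ / |y ^ 2 - 3| + 1)) :
    sInf {p : ℝ | ∃ v : ℕ, 3 ≤ v ∧ p = J v y}
      = sInf {p : ℝ | ∃ v : ℕ, 3 ≤ v ∧ v ≤ ⌊v₀⌋₊ + 3 ∧ p = J v y} := by
  have hy0 : 0 < y := (Real.sqrt_nonneg 3).trans_lt hy
  have hs : 3 < y ^ 2 := (Real.sqrt_lt' hy0).1 hy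
  have hC₁0 : 0 ≤ C₁ := by rw [hC₁]; positivity
  have hC₂0 : 0 ≤ C₂ := by rw [hC₂]; positivity
  have hV₁v : V₁ ≤ v₀ := by
    rw [hv₀, hV₃, hV₂]
    exact le_max_of_le_left (le_max_of_le_left (le_max_left _ _))
  have h100 : 100 ≤ v₀ := (hV₁ ▸ le_max_left _ _ : (100 : ℝ) ≤ V₁).trans hV₁v
  have h8 : 8 * y ^ 2 ≤ v₀ := (hV₁ ▸ le_max_right _ _ : 8 * y ^ 2 ≤ V₁).trans hV₁v
  have hratio : 2 * C₃ / (y ^ 2 - 3) ≤ v₀ := by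
    have h : 2 * C₃ / |y ^ 2 - 3| + 1 ≤ v₀ := hv₀ ▸ le_max_right _ _
    rw [abs_of_pos (by linarith)] at h
    linarith
  refine sInf_eq_of_le_add_two (fun v => J v y) (⌊v₀⌋₊ + 3) ?_ fun n hn => ?_
  · have : 1 ≤ ⌊v₀⌋₊ := Nat.one_le_floor_iff _ |>.2 (by linarith)
    lia
  · have hn' : v₀ ≤ n := by
      have h₁ := Nat.lt_floor_add_one v₀
      have h₂ : ((⌊v₀⌋₊ + 3 : ℕ) : ℝ) ≤ ((n + 1 : ℕ) : ℝ) := Nat.cast_le.2 hn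
      push_cast at h₂
      linarith
    have hgap := (div_le_iff₀ (by linarith)).1 (hratio.trans hn')
    push_cast
    refine J_le_J_add_two hy0 (h100.trans hn') hs (h8.trans hn') (le_trans ?_ hgap)
    nlinarith [sq_nonneg (y ^ 2)]
end
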